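/- arXiv:2102.10964 — 5 statements merged into one kernel-verified Lean document; each statement's English description precedes it below -/
import Mathlib

section
/- Let δ : ℝ → [0, ∞) be a measurable function with strictly positive, finite Gaussian-smoothed integrals, let m > 0, let σ_1,…,σ_k > 0, let (λ_{ij})_{1≤i≤m, 1≤j≤k} satisfy ∑_{i=1}^m λ_{ij}² = 1 for every j, let (y_{ij}) ∈ ℝ^{m×k}, and set s̃_j = ∑_{i=1}^m λ_{ij}² y_{ij}. Define J = ∫_{ℝ^k} exp(−∑_{i=1}^m ∑_{j=1}^k (m λ_{ij}²/(2σ_j²)) (y_{ij} − s_j)²) ∏_{j=1}^k δ(s_j) ds. Then −log J = ∑_{i=1}^m ∑_{j=1}^k (m/(2σ_j²)) λ_{ij}² (y_{ij} − s̃_j)² + ∑_{j=1}^k f(s̃_j, σ_j), where f(s, σ) = −log( ∫_ℝ exp(−(m/(2σ²)) z²) δ(s − z) dz ). -/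
open MeasureTheory Finset

theorem avica_lintegral_prod (k : ℕ) (g : Fin k → ℝ → ENNReal) (hg : ∀ j, Measurable (g j)) :
    ∫⁻ s : Fin k → ℝ, ∏ j, g j (s j) = ∏ j, ∫⁻ x, g j x := by
  induction k with
  | zero => simp [volume_pi]
  | succ n ih =>
    have h := (volume_preserving_piFinSuccAbove (fun _ : Fin (n + 1) => ℝ) 0).symm
    rw [← h.lintegral_comp (by fun_prop), Fin.prod_univ_succ, ← ih (fun j => g j.succ) (fun j => hg _)]
    have h2 : ∀ p : ℝ × (Fin n → ℝ),
        ∏ j, g j ((MeasurableEquiv.piFinSuccAbove (fun _ : Fin (n + 1) => ℝ) 0).symm p j)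
          = g 0 p.1 * ∏ j : Fin n, g j.succ (p.2 j) := by
      intro p
      rw [Fin.prod_univ_succ]
      simp [MeasurableEquiv.piFinSuccAbove]
    simp only [h2]
    exact lintegral_prod_mul (f := g 0) (g := fun s : Fin n → ℝ => ∏ j : Fin n, g j.succ (s j))
      (hg 0).aemeasurable
      (Finset.measurable_prod _ fun j _ => (hg j.succ).comp (measurable_pi_apply j)).aemeasurable

theorem avica_sq (m : ℕ) (l y : Fin m → ℝ) (h : ∑ i, l i ^ 2 = 1) (t s : ℝ)
    (ht : t = ∑ i, l i ^ 2 * y i) :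
    ∑ i, l i ^ 2 * (y i - s) ^ 2 = ∑ i, l i ^ 2 * (y i - t) ^ 2 + (t - s) ^ 2 := by
  have e : ∀ i, l i ^ 2 * (y i - s) ^ 2 = l i ^ 2 * (y i - t) ^ 2
      + (2 * (t - s) * (l i ^ 2 * y i) + ((t - s) ^ 2 - 2 * (t - s) * t) * l i ^ 2) := by
    intro i; ring
  simp only [e, sum_add_distrib, ← mul_sum, h, ← ht]
  ring

/-- Closed form of the marginal likelihood integral in AVICA: with weights over views
`lam i j ^ 2` summing (over `i`) to one, weighted averages `st j = ∑ i, lam i j ^ 2 * y i j`,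
and Gaussian-smoothed integrals `C j = ∫ exp(−(m/(2σⱼ²)) z²) δ(st j − z) dz` assumed
strictly positive and finite,
`−log J = ∑ᵢ∑ⱼ (m/(2σⱼ²)) λᵢⱼ² (yᵢⱼ − s̃ⱼ)² + ∑ⱼ f(s̃ⱼ, σⱼ)` where
`J = ∫_{ℝᵏ} exp(−∑ᵢ∑ⱼ (m λᵢⱼ²/(2σⱼ²))(yᵢⱼ − sⱼ)²) ∏ⱼ δ(sⱼ) ds` and `f(s, σ) = −log C`. -/
theorem avica_neg_log_marginal_integral
    (δ : ℝ → ℝ) (hδmeas : Measurable δ) (hδnonneg : 0 ≤ δ)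
    (m k : ℕ) (hm : 0 < m) (σ : Fin k → ℝ) (hσ : ∀ j, 0 < σ j)
    (lam y : Fin m → Fin k → ℝ) (hlam : ∀ j, ∑ i, (lam i j) ^ 2 = 1)
    (st : Fin k → ℝ) (hst : ∀ j, st j = ∑ i, (lam i j) ^ 2 * y i j)
    (C : Fin k → ENNReal)
    (hC : ∀ j, C j = ∫⁻ z : ℝ, ENNReal.ofReal
      (Real.exp (-((m : ℝ) / (2 * σ j ^ 2)) * z ^ 2) * δ (st j - z)))
    (hCpos : ∀ j, 0 < C j) (hCfin : ∀ j, C j < ⊤)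
    (J : ENNReal)
    (hJ : J = ∫⁻ s : Fin k → ℝ, ENNReal.ofReal
        (Real.exp (-∑ i, ∑ j, ((m : ℝ) * (lam i j) ^ 2 / (2 * σ j ^ 2)) * (y i j - s j) ^ 2))
      * ∏ j, ENNReal.ofReal (δ (s j))) :
    -Real.log J.toReal
      = (∑ i, ∑ j, ((m : ℝ) / (2 * σ j ^ 2)) * (lam i j) ^ 2 * (y i j - st j) ^ 2)
        + ∑ j, -Real.log (C j).toReal := by
  set A : ℝ := ∑ i, ∑ j, ((m : ℝ) / (2 * σ j ^ 2)) * (lam i j) ^ 2 * (y i j - st j) ^ 2 with hA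
  have hexp : ∀ s : Fin k → ℝ,
      ∑ i, ∑ j, ((m : ℝ) * (lam i j) ^ 2 / (2 * σ j ^ 2)) * (y i j - s j) ^ 2
        = A + ∑ j, ((m : ℝ) / (2 * σ j ^ 2)) * (st j - s j) ^ 2 := by
    intro s
    rw [hA, sum_comm, sum_comm (s := univ (α := Fin m)), ← sum_add_distrib]
    refine sum_congr rfl fun j _ => ?_
    have := avica_sq m (fun i => lam i j) (fun i => y i j) (hlam j) (st j) (s j) (hst j)
    simp only [mul_assoc, ← mul_sum]
    rw [← mul_add, ← this, mul_sum]
    refine sum_congr rfl fun i _ => ?_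
    ring
  clear_value A
  have hCj : ∀ j, C j = ∫⁻ x : ℝ, ENNReal.ofReal
      (Real.exp (-((m : ℝ) / (2 * σ j ^ 2) * (st j - x) ^ 2)) * δ x) := by
    intro j
    rw [hC j, ← (Measure.measurePreserving_sub_left volume (st j)).lintegral_comp (by fun_prop)]
    simp only [sub_sub_cancel, neg_mul]
  have hJ2 : J = ENNReal.ofReal (Real.exp (-A)) * ∏ j, C j := by
    rw [hJ]
    simp only [hCj]
    rw [← avica_lintegral_prod k (fun j x => ENNReal.ofReal
      (Real.exp (-((m : ℝ) / (2 * σ j ^ 2) * (st j - x) ^ 2)) * δ x)) (fun j => by fun_prop),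
      ← lintegral_const_mul _ (by fun_prop)]
    refine lintegral_congr fun s => ?_
    rw [hexp s, neg_add, Real.exp_add, ENNReal.ofReal_mul (Real.exp_pos _).le, mul_assoc,
      ← sum_neg_distrib, Real.exp_sum, ENNReal.ofReal_prod_of_nonneg (fun _ _ => (Real.exp_pos _).le),
      ← prod_mul_distrib]
    congr 1
    refine prod_congr rfl fun j _ => ?_
    rw [ENNReal.ofReal_mul (Real.exp_pos _).le]
  have hne : ∀ j, (C j).toReal ≠ 0 := fun j =>
    (ENNReal.toReal_pos (hCpos j).ne' (hCfin j).ne).ne'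
  rw [hJ2, ENNReal.toReal_mul, ENNReal.toReal_ofReal (Real.exp_pos _).le, ENNReal.toReal_prod,
    Real.log_mul (Real.exp_pos _).ne' (prod_ne_zero_iff.2 fun j _ => hne j), Real.log_exp,
    Real.log_prod (fun j _ => hne j), sum_neg_distrib]
  ring
end

section
/- Let δ : ℝ → [0, ∞) be a probability density, let m be the number of views and k the number of sources, let W^1,…,W^m ∈ ℝ^{k×k} be invertible, let σ_1,…,σ_k > 0, let (λ_{ij}) be nonzero reals with ∑_{i=1}^m λ_{ij}² = 1 for every j, let x^1,…,x^m ∈ ℝ^k, and set y^i = W^i x^i and s̃_j = ∑_{i=1}^m λ_{ij}² y^i_j. Define the AVICA marginal density p(x^1,…,x^m) = ∏_{i=1}^m |det W^i| · ∫_{ℝ^k} ∏_{i=1}^m ∏_{j=1}^k N(y^i_j; s_j, σ_j²/(m λ_{ij}²)) · ∏_{j=1}^k δ(s_j) ds. Then, assuming the inner integral is positive and finite, −log p(x^1,…,x^m) = ∑_{i=1}^m [ −log|det W^i| + ½ ∑_{j=1}^k log(2π σ_j²/(m λ_{ij}²)) ] + ∑_{i=1}^m ∑_{j=1}^k (m λ_{ij}²/(2σ_j²))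 (y^i_j − s̃_j)² + ∑_{j=1}^k f(s̃_j, σ_j), where f(s, σ) = −log( ∫_ℝ exp(−(m/(2σ²)) z²) δ(s − z) dz ). -/
open MeasureTheory Finset Real

/-- The one-dimensional Gaussian probability density with mean `μ` and variance `v`. -/
noncomputable def gaussPDF (x μ v : ℝ) : ℝ :=
  (Real.sqrt (2 * Real.pi * v))⁻¹ * Real.exp (-(x - μ) ^ 2 / (2 * v))

/-- Completing the square for one source. -/
lemma avica_square {m : ℕ} (l y : Fin m → ℝ) (h : ∑ i, l i ^ 2 = 1) (t u c : ℝ)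
    (ht : t = ∑ i, l i ^ 2 * y i) :
    ∑ i, c * l i ^ 2 * (y i - u) ^ 2
      = ∑ i, c * l i ^ 2 * (y i - t) ^ 2 + c * (t - u) ^ 2 := by
  have e : ∀ i, c * l i ^ 2 * (y i - u) ^ 2 = c * l i ^ 2 * (y i - t) ^ 2
      + (2 * c * (t - u) * (l i ^ 2 * y i) + (c * (t - u) ^ 2 - 2 * c * (t - u) * t) * l i ^ 2) := by
    intro i; ring
  simp_rw [e]
  rw [Finset.sum_add_distrib, Finset.sum_add_distrib, ← Finset.mul_sum, ← Finset.mul_sum, ← ht, h]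
  ring

/-- Closed form of the AVICA negative log marginal density.  With unmixed data
`y i = W i • x i`, precision-weighted averages `st j = ∑ i, lam i j ^ 2 * y i j`,
and the marginal density
`p = ∏ᵢ |det Wⁱ| · ∫_{ℝᵏ} ∏ᵢ∏ⱼ N(yⁱⱼ; sⱼ, σⱼ²/(m λᵢⱼ²)) · ∏ⱼ δ(sⱼ) ds`
(whose inner integral is assumed positive and finite), one has
`−log p = ∑ᵢ [−log|det Wⁱ| + ½ ∑ⱼ log(2πσⱼ²/(m λᵢⱼ²))]
  + ∑ᵢ∑ⱼ (m λᵢⱼ²/(2σⱼ²)) (yᵢⱼ − s̃ⱼ)² + ∑ⱼ f(s̃ⱼ, σⱼ)`, where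
`f(s, σ) = −log ∫ exp(−(m/(2σ²)) z²) δ(s − z) dz`. -/
theorem avica_neg_log_marginal_density
    (δ : ℝ → ℝ) (hδmeas : Measurable δ) (hδnonneg : 0 ≤ δ)
    (hδprob : ∫ u : ℝ, δ u = 1)
    (m k : ℕ) (W : Fin m → Matrix (Fin k) (Fin k) ℝ) (hW : ∀ i, IsUnit (W i).det)
    (σ : Fin k → ℝ) (hσ : ∀ j, 0 < σ j)
    (lam : Fin m → Fin k → ℝ) (hlam_ne : ∀ i j, lam i j ≠ 0)
    (hlam : ∀ j, ∑ i, (lam i j) ^ 2 = 1)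
    (x : Fin m → Fin k → ℝ)
    (y : Fin m → Fin k → ℝ) (hy : ∀ i, y i = (W i).mulVec (x i))
    (st : Fin k → ℝ) (hst : ∀ j, st j = ∑ i, (lam i j) ^ 2 * y i j)
    (I : ℝ)
    (hI : I = ∫ s : Fin k → ℝ,
      (∏ i, ∏ j, gaussPDF (y i j) (s j) (σ j ^ 2 / ((m : ℝ) * (lam i j) ^ 2)))
        * ∏ j, δ (s j))
    (hIint : Integrable fun s : Fin k → ℝ =>
      (∏ i, ∏ j, gaussPDF (y i j) (s j) (σ j ^ 2 / ((m : ℝ) * (lam i j) ^ 2)))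
        * ∏ j, δ (s j))
    (hIpos : 0 < I)
    (p : ℝ) (hp : p = (∏ i, |(W i).det|) * I) :
    -Real.log p
      = (∑ i, (-Real.log |(W i).det|
          + (1 / 2) * ∑ j, Real.log (2 * Real.pi * σ j ^ 2 / ((m : ℝ) * (lam i j) ^ 2))))
        + (∑ i, ∑ j, ((m : ℝ) * (lam i j) ^ 2 / (2 * σ j ^ 2)) * (y i j - st j) ^ 2)
        + ∑ j, -Real.log (∫ z : ℝ,
            Real.exp (-((m : ℝ) / (2 * σ j ^ 2)) * z ^ 2) * δ (st j - z)) := by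
  have hJ : ∀ j, (∫ u : ℝ, (∏ i, gaussPDF (y i j) u (σ j ^ 2 / ((m : ℝ) * (lam i j) ^ 2))) * δ u)
      = ((∏ i, (Real.sqrt (2 * Real.pi * (σ j ^ 2 / ((m : ℝ) * (lam i j) ^ 2))))⁻¹)
        * Real.exp (-∑ i, ((m : ℝ) / (2 * σ j ^ 2)) * lam i j ^ 2 * (y i j - st j) ^ 2))
        * ∫ z : ℝ, Real.exp (-((m : ℝ) / (2 * σ j ^ 2)) * z ^ 2) * δ (st j - z) := by
    intro j
    rw [← integral_sub_left_eq_self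
      (fun z : ℝ => Real.exp (-((m : ℝ) / (2 * σ j ^ 2)) * z ^ 2) * δ (st j - z)) volume (st j),
      ← integral_const_mul]
    congr 1
    ext u
    have h1 : ∀ i, -(y i j - u) ^ 2 / (2 * (σ j ^ 2 / ((m : ℝ) * (lam i j) ^ 2)))
        = -(((m : ℝ) / (2 * σ j ^ 2)) * lam i j ^ 2 * (y i j - u) ^ 2) := by
      intro i
      have hm : (m : ℝ) ≠ 0 := by
        have := i.pos
        positivity
      have := hlam_ne i j
      have := (hσ j).ne'
      field_simp
    simp only [gaussPDF]
    simp_rw [h1]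
    rw [Finset.prod_mul_distrib, ← Real.exp_sum, Finset.sum_neg_distrib,
      avica_square (fun i => lam i j) (fun i => y i j) (hlam j) (st j) u _ (hst j),
      neg_add, Real.exp_add, sub_sub_cancel, neg_mul]
    ring
  have hI2 : I = ∏ j, (((∏ i, (Real.sqrt (2 * Real.pi * (σ j ^ 2 / ((m : ℝ) * (lam i j) ^ 2))))⁻¹)
        * Real.exp (-∑ i, ((m : ℝ) / (2 * σ j ^ 2)) * lam i j ^ 2 * (y i j - st j) ^ 2))
        * ∫ z : ℝ, Real.exp (-((m : ℝ) / (2 * σ j ^ 2)) * z ^ 2) * δ (st j - z)) := by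
    rw [hI]
    simp_rw [← hJ]
    rw [← integral_fintype_prod_volume_eq_prod
      (fun j u => (∏ i, gaussPDF (y i j) u (σ j ^ 2 / ((m : ℝ) * (lam i j) ^ 2))) * δ u)]
    congr 1
    ext s
    rw [Finset.prod_comm, Finset.prod_mul_distrib]
  have hne := hIpos.ne'
  rw [hI2, Finset.prod_ne_zero_iff] at hne
  have hd : ∀ i, |(W i).det| ≠ 0 := fun i => abs_ne_zero.mpr (hW i).ne_zero
  have hv : ∀ i j, 0 < 2 * Real.pi * (σ j ^ 2 / ((m : ℝ) * (lam i j) ^ 2)) := by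
    intro i j
    have := i.pos
    have := hlam_ne i j
    have := hσ j
    positivity
  have hlog : ∀ j, Real.log (((∏ i, (Real.sqrt (2 * Real.pi * (σ j ^ 2 / ((m : ℝ) * (lam i j) ^ 2))))⁻¹)
        * Real.exp (-∑ i, ((m : ℝ) / (2 * σ j ^ 2)) * lam i j ^ 2 * (y i j - st j) ^ 2))
        * ∫ z : ℝ, Real.exp (-((m : ℝ) / (2 * σ j ^ 2)) * z ^ 2) * δ (st j - z))
      = -(∑ i, (1 / 2) * Real.log (2 * Real.pi * σ j ^ 2 / ((m : ℝ) * (lam i j) ^ 2)))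
        - (∑ i, ((m : ℝ) * (lam i j) ^ 2 / (2 * σ j ^ 2)) * (y i j - st j) ^ 2)
        + Real.log (∫ z : ℝ, Real.exp (-((m : ℝ) / (2 * σ j ^ 2)) * z ^ 2) * δ (st j - z)) := by
    intro j
    have h := hne j (Finset.mem_univ j)
    have ha := left_ne_zero_of_mul h
    rw [Real.log_mul ha (right_ne_zero_of_mul h),
      Real.log_mul (left_ne_zero_of_mul ha) (right_ne_zero_of_mul ha), Real.log_exp,
      Real.log_prod (fun i _ => inv_ne_zero (Real.sqrt_pos.mpr (hv i j)).ne'),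
      ← sub_eq_add_neg]
    congr 1
    congr 1
    · rw [← Finset.sum_neg_distrib]
      refine Finset.sum_congr rfl fun i _ => ?_
      rw [Real.log_inv, Real.log_sqrt (hv i j).le, mul_div_assoc]
      ring
    · refine Finset.sum_congr rfl fun i _ => ?_
      ring
  rw [hp, Real.log_mul (Finset.prod_ne_zero_iff.mpr fun i _ => hd i) hIpos.ne',
    Real.log_prod (fun i _ => hd i), hI2, Real.log_prod hne]
  simp_rw [hlog]
  simp only [Finset.sum_add_distrib, Finset.sum_sub_distrib, Finset.sum_neg_distrib, Finset.mul_sum]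
  rw [Finset.sum_comm (f := fun (j : Fin k) (i : Fin m) =>
      1 / 2 * Real.log (2 * Real.pi * σ j ^ 2 / ((m : ℝ) * (lam i j) ^ 2))),
    Finset.sum_comm (f := fun (j : Fin k) (i : Fin m) =>
      ((m : ℝ) * (lam i j) ^ 2 / (2 * σ j ^ 2)) * (y i j - st j) ^ 2)]
  ring
end

section
/- Let p : ℝ → [0, ∞) be a probability density with finite first moment and zero mean (∫_ℝ |s| p(s) ds < ∞ and ∫_ℝ s p(s) ds = 0), let r_1,…,r_m > 0 and y_1,…,y_m ∈ ℝ, and define g : ℝ^m → ℝ by g(a) = ∫_ℝ ∏_{i=1}^m N(y_i − a_i s; 0, r_i²) p(s) ds. Then g(0) > 0, g is differentiable at a = 0 in each coordinate, and ∂g/∂a_i (0) = 0 for every i = 1,…,m; consequently a = 0 is a stationary point of h = log g. -/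
open MeasureTheory Finset

lemma gaussPDF_pos' (x v : ℝ) (hv : 0 < v) : 0 < gaussPDF x 0 v := by
  unfold gaussPDF
  have := Real.pi_pos
  positivity

lemma gaussPDF_hasDerivAt (y s t v : ℝ) (hv : 0 < v) :
    HasDerivAt (fun t : ℝ => gaussPDF (y - t * s) 0 v)
      (s * ((y - t * s) / v * gaussPDF (y - t * s) 0 v)) t := by
  unfold gaussPDF
  have h1 : HasDerivAt (fun t : ℝ => y - t * s) (-s) t := by
    simpa using ((hasDerivAt_id t).mul_const s).const_sub y
  have h2 := ((((h1.sub_const 0).pow 2).neg.div_const (2 * v)).exp).const_mul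
    (Real.sqrt (2 * Real.pi * v))⁻¹
  refine h2.congr_deriv ?_
  simp
  field_simp

lemma gaussPDF_bound (v : ℝ) (hv : 0 < v) :
    ∃ B : ℝ, 0 ≤ B ∧ ∀ u : ℝ, |u / v * gaussPDF u 0 v| ≤ B := by
  have hK : 0 ≤ (Real.sqrt (2 * Real.pi * v))⁻¹ := by positivity
  refine ⟨(1 + 1 / (2 * v)) * (Real.sqrt (2 * Real.pi * v))⁻¹, by positivity, fun u => ?_⟩
  rw [abs_mul, abs_of_pos (gaussPDF_pos' u v hv), abs_div, abs_of_pos hv]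
  unfold gaussPDF
  have h1 : |u| / v ≤ (1 + 1 / (2 * v)) * Real.exp (u ^ 2 / (2 * v)) := by
    have h2 := Real.add_one_le_exp (u ^ 2 / (2 * v))
    have h3 : |u| / v ≤ (1 + u ^ 2) / (2 * v) := by
      rw [div_le_div_iff₀ hv (by positivity)]
      have := sq_abs u
      nlinarith [mul_nonneg hv.le (sq_nonneg (|u| - 1))]
    have h4 : 0 ≤ 1 / (2 * v) := by positivity
    have h5 : 0 ≤ u ^ 2 / (2 * v) := by positivity
    calc |u| / v ≤ (1 + u ^ 2) / (2 * v) := h3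
      _ = 1 / (2 * v) + u ^ 2 / (2 * v) := by ring
      _ ≤ (1 + 1 / (2 * v)) * (u ^ 2 / (2 * v) + 1) := by nlinarith [mul_nonneg h4 h5]
      _ ≤ _ := by gcongr
  have h6 : Real.exp (u ^ 2 / (2 * v)) * Real.exp (-(u - 0) ^ 2 / (2 * v)) = 1 := by
    rw [← Real.exp_add, ← Real.exp_zero]
    congr 1
    ring
  calc _ ≤ ((1 + 1 / (2 * v)) * Real.exp (u ^ 2 / (2 * v))) *
        ((Real.sqrt (2 * Real.pi * v))⁻¹ * Real.exp (-(u - 0) ^ 2 / (2 * v))) := by gcongr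
    _ = (1 + 1 / (2 * v)) * (Real.sqrt (2 * Real.pi * v))⁻¹ *
        (Real.exp (u ^ 2 / (2 * v)) * Real.exp (-(u - 0) ^ 2 / (2 * v))) := by ring
    _ = _ := by rw [h6, mul_one]

lemma gaussPDF_integral_deriv (p : ℝ → ℝ) (hpmeas : Measurable p)
    (hpint : Integrable p)
    (hpmoment : Integrable fun s : ℝ => s * p s)
    (hpmean : ∫ s : ℝ, s * p s = 0) (y v : ℝ) (hv : 0 < v) :
    HasDerivAt (fun t : ℝ => ∫ s : ℝ, gaussPDF (y - t * s) 0 v * p s) 0 0 := by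
  obtain ⟨B, hB, hBb⟩ := gaussPDF_bound v hv
  have hcont : Continuous fun u : ℝ => gaussPDF u 0 v := by
    unfold gaussPDF
    fun_prop
  have key := hasDerivAt_integral_of_dominated_loc_of_deriv_le (μ := volume)
    (F := fun t s : ℝ => gaussPDF (y - t * s) 0 v * p s)
    (F' := fun t s : ℝ => s * ((y - t * s) / v * gaussPDF (y - t * s) 0 v) * p s)
    (x₀ := (0 : ℝ)) (s := Set.univ) (bound := fun s => B * |s * p s|)
    Filter.univ_mem
    (Filter.Eventually.of_forall fun t =>
      ((hcont.comp (by fun_prop : Continuous fun s : ℝ => y - t * s)).measurable.mul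
        hpmeas).aestronglyMeasurable)
    (by simpa using hpint.const_mul (gaussPDF y 0 v))
    (by
      have : Measurable fun s : ℝ => gaussPDF (y - 0 * s) 0 v :=
        (hcont.comp (by fun_prop : Continuous fun s : ℝ => y - 0 * s)).measurable
      exact Measurable.aestronglyMeasurable (by fun_prop))
    (Filter.Eventually.of_forall fun s t _ => by
      rw [Real.norm_eq_abs]
      calc |s * ((y - t * s) / v * gaussPDF (y - t * s) 0 v) * p s|
          = |(y - t * s) / v * gaussPDF (y - t * s) 0 v| * |s * p s| := by
            rw [← abs_mul]; congr 1; ring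
        _ ≤ _ := by gcongr; exact hBb _)
    (hpmoment.abs.const_mul B)
    (Filter.Eventually.of_forall fun s t _ => (gaussPDF_hasDerivAt y s t v hv).mul_const (p s))
  refine key.2.congr_deriv ?_
  have : ∀ s : ℝ, s * ((y - 0 * s) / v * gaussPDF (y - 0 * s) 0 v) * p s
      = (y / v * gaussPDF y 0 v) * (s * p s) := fun s => by
    simp only [zero_mul, sub_zero]; ring
  simp only [this]
  rw [integral_const_mul, hpmean, mul_zero]

/-- For the likelihood `g(a) = ∫ ∏ᵢ N(yᵢ − aᵢ s; 0, rᵢ²) p(s) ds` of the model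
`yᵢ = aᵢ s + nᵢ` with a zero-mean source density `p` of finite first moment:
`g(0) > 0`, `g` is differentiable in each coordinate at `a = 0` with vanishing
partial derivatives, and consequently `a = 0` is a stationary point of `h = log g`. -/
theorem avica_zero_mixing_stationary_point
    (p : ℝ → ℝ) (hpmeas : Measurable p) (hpnonneg : 0 ≤ p)
    (hpprob : ∫ s : ℝ, p s = 1)
    (hpmoment : Integrable fun s : ℝ => s * p s)
    (hpmean : ∫ s : ℝ, s * p s = 0)
    (m : ℕ) (r y : Fin m → ℝ) (hr : ∀ i, 0 < r i)
    (g : (Fin m → ℝ) → ℝ)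
    (hg : ∀ a, g a = ∫ s : ℝ, (∏ i, gaussPDF (y i - a i * s) 0 (r i ^ 2)) * p s) :
    0 < g 0 ∧
    (∀ i, HasDerivAt (fun t : ℝ => g (Pi.single i t)) 0 0) ∧
    (∀ i, HasDerivAt (fun t : ℝ => Real.log (g (Pi.single i t))) 0 0) := by
  have hpint : Integrable p := by
    by_contra h
    rw [integral_undef h] at hpprob
    exact zero_ne_one hpprob
  have hv : ∀ i, 0 < r i ^ 2 := fun i => pow_pos (hr i) 2
  have h0 : 0 < g 0 := by
    rw [hg]
    simp only [Pi.zero_apply, zero_mul, sub_zero]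
    rw [integral_const_mul, hpprob, mul_one]
    exact Finset.prod_pos fun i _ => gaussPDF_pos' _ _ (hv i)
  have h1 : ∀ i, HasDerivAt (fun t : ℝ => g (Pi.single i t)) 0 0 := by
    intro i
    have h := (gaussPDF_integral_deriv p hpmeas hpint hpmoment hpmean (y i) (r i ^ 2)
      (hv i)).const_mul (∏ j ∈ univ.erase i, gaussPDF (y j) 0 (r j ^ 2))
    rw [mul_zero] at h
    refine h.congr_of_eventuallyEq (Filter.Eventually.of_forall fun t => ?_)
    beta_reduce
    rw [hg, ← integral_const_mul]
    congr 1
    funext s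
    rw [← Finset.mul_prod_erase univ _ (mem_univ i), Pi.single_eq_same]
    have : ∏ j ∈ univ.erase i, gaussPDF (y j - (Pi.single i t : Fin m → ℝ) j * s) 0 (r j ^ 2)
        = ∏ j ∈ univ.erase i, gaussPDF (y j) 0 (r j ^ 2) := by
      refine Finset.prod_congr rfl fun j hj => ?_
      rw [Pi.single_eq_of_ne (Finset.ne_of_mem_erase hj), zero_mul, sub_zero]
    rw [this]
    ring
  refine ⟨h0, h1, fun i => ?_⟩
  have := (h1 i).log (by rw [Pi.single_zero]; exact h0.ne')
  simpa using this
end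

section
/- Let p : ℝ → [0, ∞) be a probability density with ∫_ℝ s p(s) ds = 0 and ∫_ℝ s² p(s) ds = 1 (and finite second moment), let r_1,…,r_m > 0 and y_1,…,y_m ∈ ℝ, and define h(a) = log ∫_ℝ ∏_{i=1}^m N(y_i − a_i s; 0, r_i²) p(s) ds. Then h is twice differentiable at a = 0 and its Hessian at 0 satisfies: ∂²h/∂a_i ∂a_j (0) = y_i y_j/(r_i² r_j²) for i ≠ j, and ∂²h/∂a_i² (0) = y_i²/r_i⁴ − 1/r_i². -/
open MeasureTheory Finset

lemma avica_key {E V : Type*} [NormedAddCommGroup E] [NormedSpace ℝ E]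
    [NormedAddCommGroup V] [NormedSpace ℝ V]
    (F : E → V) (F' : E → E →L[ℝ] V) (hF : ∀ z, HasFDerivAt F (F' z) z)
    (hF'c : Continuous F') (C C' : ℝ) (hC : ∀ z, ‖F z‖ ≤ C) (hC' : ∀ z, ‖F' z‖ ≤ C')
    (w : ℝ → ℝ) (hw : Integrable w) (hsw : Integrable fun s => s * w s) (a : E) :
    HasFDerivAt (fun a => ∫ s, w s • F (s • a)) (∫ s, (s * w s) • F' (s • a)) a := by
  have hFc : Continuous F := continuous_iff_continuousAt.2 fun z => (hF z).continuousAt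
  have hm : ∀ x : E, AEStronglyMeasurable (fun s : ℝ => w s • F (s • x)) volume := fun x =>
    hw.aestronglyMeasurable.smul
      ((hFc.comp (by fun_prop : Continuous fun s : ℝ => s • x)).aestronglyMeasurable)
  refine hasFDerivAt_integral_of_dominated_of_fderiv_le (𝕜 := ℝ)
    (F := fun a s => w s • F (s • a)) (F' := fun a s => (s * w s) • F' (s • a)) (s := Set.univ)
    (bound := fun s => ‖s * w s‖ * C') Filter.univ_mem (Filter.Eventually.of_forall hm) ?_ ?_ ?_ ?_ ?_
  · refine Integrable.mono' (hw.norm.mul_const C) (hm a) (Filter.Eventually.of_forall fun s => ?_)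
    rw [norm_smul]
    exact mul_le_mul_of_nonneg_left (hC _) (norm_nonneg _)
  · exact hsw.aestronglyMeasurable.smul
      ((hF'c.comp (by fun_prop : Continuous fun s : ℝ => s • a)).aestronglyMeasurable)
  · refine Filter.Eventually.of_forall fun s x _ => ?_
    rw [norm_smul]
    exact mul_le_mul_of_nonneg_left (hC' _) (norm_nonneg _)
  · exact hsw.norm.mul_const C'
  · refine Filter.Eventually.of_forall fun s x _ => ?_
    have h1 : HasFDerivAt (fun x : E => s • x) (s • ContinuousLinearMap.id ℝ E) x :=
      (hasFDerivAt_id x).const_smul s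
    have h2 := ((hF (s • x)).comp x h1).const_smul (w s)
    refine h2.congr_fderiv ?_
    ext v
    simp [smul_smul, mul_comm]

lemma avica_key_cont {E V : Type*} [NormedAddCommGroup E] [NormedSpace ℝ E]
    [NormedAddCommGroup V] [NormedSpace ℝ V]
    (F : E → V) (hFc : Continuous F) (C : ℝ) (hC : ∀ z, ‖F z‖ ≤ C)
    (w : ℝ → ℝ) (hw : Integrable w) :
    Continuous (fun a => ∫ s, w s • F (s • a)) := by
  refine continuous_of_dominated (bound := fun s => ‖w s‖ * C) (fun x => ?_) (fun x => ?_) ?_ ?_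
  · exact hw.aestronglyMeasurable.smul
      ((hFc.comp (by fun_prop : Continuous fun s : ℝ => s • x)).aestronglyMeasurable)
  · refine Filter.Eventually.of_forall fun s => ?_
    rw [norm_smul]
    exact mul_le_mul_of_nonneg_left (hC _) (norm_nonneg _)
  · exact hw.norm.mul_const C
  · exact Filter.Eventually.of_forall fun s => by fun_prop

/-- exponent -/
noncomputable def avQ {m : ℕ} (r y z : Fin m → ℝ) : ℝ := ∑ i, (y i - z i) ^ 2 / (2 * r i ^ 2)

noncomputable def avC {m : ℕ} (r : Fin m → ℝ) : ℝ := ∏ i, (Real.sqrt (2 * Real.pi * r i ^ 2))⁻¹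

noncomputable def avF {m : ℕ} (r y z : Fin m → ℝ) : ℝ := avC r * Real.exp (-avQ r y z)

noncomputable def avL {m : ℕ} (r y z : Fin m → ℝ) : (Fin m → ℝ) →L[ℝ] ℝ :=
  ∑ i, ((y i - z i) / r i ^ 2) • ContinuousLinearMap.proj (R := ℝ) (φ := fun _ : Fin m => ℝ) i

noncomputable def avM {m : ℕ} (r : Fin m → ℝ) : (Fin m → ℝ) →L[ℝ] (Fin m → ℝ) →L[ℝ] ℝ :=
  ∑ i, (ContinuousLinearMap.proj (R := ℝ) (φ := fun _ : Fin m => ℝ) i).smulRight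
    ((-1 / r i ^ 2) • ContinuousLinearMap.proj (R := ℝ) (φ := fun _ : Fin m => ℝ) i)

noncomputable def avF1 {m : ℕ} (r y z : Fin m → ℝ) : (Fin m → ℝ) →L[ℝ] ℝ :=
  avF r y z • avL r y z

noncomputable def avF2 {m : ℕ} (r y z : Fin m → ℝ) : (Fin m → ℝ) →L[ℝ] (Fin m → ℝ) →L[ℝ] ℝ :=
  avF r y z • avM r + (avF1 r y z).smulRight (avL r y z)

lemma avC_pos {m : ℕ} (r : Fin m → ℝ) (hr : ∀ i, 0 < r i) : 0 < avC r := by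
  refine Finset.prod_pos fun i _ => ?_
  have := hr i
  have := Real.pi_pos
  positivity

lemma avQ_nonneg {m : ℕ} (r y z : Fin m → ℝ) : 0 ≤ avQ r y z :=
  Finset.sum_nonneg fun i _ => by positivity

lemma avF_hasFDerivAt {m : ℕ} (r y : Fin m → ℝ) (hr : ∀ i, 0 < r i) (z : Fin m → ℝ) :
    HasFDerivAt (avF r y) (avF1 r y z) z := by
  have hQ : HasFDerivAt (avQ r y) (-avL r y z) z := by
    have : HasFDerivAt (avQ r y) (∑ i, (-(y i - z i) / r i ^ 2) •
        ContinuousLinearMap.proj (R := ℝ) (φ := fun _ : Fin m => ℝ) i) z := by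
      unfold avQ
      refine HasFDerivAt.fun_sum fun i _ => ?_
      have h1 : HasFDerivAt (fun x : Fin m → ℝ => x i)
        (ContinuousLinearMap.proj (R := ℝ) (φ := fun _ : Fin m => ℝ) i) z := hasFDerivAt_apply i z
      have h2 : HasDerivAt (fun t : ℝ => (y i - t) ^ 2 / (2 * r i ^ 2))
          (-(y i - z i) / r i ^ 2) (z i) := by
        have := ((((hasDerivAt_id (z i)).const_sub (y i)).pow 2).div_const (2 * r i ^ 2))
        refine this.congr_deriv ?_
        have := (hr i).ne'
        simp
        field_simp
        ring
      exact h2.comp_hasFDerivAt z h1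
    refine this.congr_fderiv ?_
    rw [avL, ← Finset.sum_neg_distrib]
    refine Finset.sum_congr rfl fun i _ => ?_
    ext v
    simp [neg_div]
    ring
  refine ((hQ.neg.exp).const_mul (avC r)).congr_fderiv ?_
  simp [avF1, avF, smul_smul]

lemma avL_hasFDerivAt {m : ℕ} (r y : Fin m → ℝ) (z : Fin m → ℝ) :
    HasFDerivAt (avL r y) (avM r) z := by
  unfold avL avM
  refine HasFDerivAt.fun_sum fun i _ => ?_
  have h1 : HasFDerivAt (fun x : Fin m → ℝ => x i)
        (ContinuousLinearMap.proj (R := ℝ) (φ := fun _ : Fin m => ℝ) i) z := hasFDerivAt_apply i z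
  have h2 := ((h1.const_sub (y i)).mul_const (r i ^ 2)⁻¹).smul_const
    (ContinuousLinearMap.proj (R := ℝ) (φ := fun _ : Fin m => ℝ) i)
  simp only [div_eq_mul_inv]
  refine h2.congr_fderiv ?_
  ext v w
  simp
  ring

lemma avF1_hasFDerivAt {m : ℕ} (r y : Fin m → ℝ) (hr : ∀ i, 0 < r i) (z : Fin m → ℝ) :
    HasFDerivAt (avF1 r y) (avF2 r y z) z :=
  (avF_hasFDerivAt r y hr z).smul (avL_hasFDerivAt r y z)

lemma avL_sq {m : ℕ} (r y z : Fin m → ℝ) (hr : ∀ i, 0 < r i) :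
    ‖avL r y z‖ ^ 2 ≤ (∑ i, 2 / r i ^ 2) * avQ r y z := by
  have h1 : ‖avL r y z‖ ≤ ∑ i, (√2 / r i) * (|y i - z i| / (√2 * r i)) := by
    refine (norm_sum_le _ _).trans (Finset.sum_le_sum fun i _ => ?_)
    rw [norm_smul]
    have hp : ‖ContinuousLinearMap.proj (R := ℝ) (φ := fun _ : Fin m => ℝ) i‖ ≤ 1 := by
      refine ContinuousLinearMap.opNorm_le_bound _ zero_le_one fun x => ?_
      simpa using norm_le_pi_norm x i
    have hri := hr i
    calc _ ≤ ‖(y i - z i) / r i ^ 2‖ * 1 := mul_le_mul_of_nonneg_left hp (norm_nonneg _)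
      _ = _ := by
        rw [mul_one, Real.norm_eq_abs, abs_div, abs_of_pos (by positivity : 0 < r i ^ 2)]
        field_simp
  calc _ ≤ (∑ i, (√2 / r i) * (|y i - z i| / (√2 * r i))) ^ 2 :=
        pow_le_pow_left₀ (norm_nonneg _) h1 2
    _ ≤ _ := Finset.sum_mul_sq_le_sq_mul_sq _ _ _
    _ = _ := by
      simp [avQ, div_pow, mul_pow]

lemma avF_nonneg {m : ℕ} (r y z : Fin m → ℝ) (hr : ∀ i, 0 < r i) : 0 < avF r y z :=
  mul_pos (avC_pos r hr) (Real.exp_pos _)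

lemma avF_le {m : ℕ} (r y z : Fin m → ℝ) (hr : ∀ i, 0 < r i) : avF r y z ≤ avC r := by
  have := avC_pos r hr
  have h2 : Real.exp (-avQ r y z) ≤ 1 := Real.exp_le_one_iff.2 (by linarith [avQ_nonneg r y z])
  unfold avF
  nlinarith

lemma avFL {m : ℕ} (r y z : Fin m → ℝ) (hr : ∀ i, 0 < r i) :
    avF r y z * ‖avL r y z‖ ^ 2 ≤ avC r * (∑ i, 2 / r i ^ 2) := by
  have hC := avC_pos r hr
  have hK : 0 ≤ ∑ i, 2 / r i ^ 2 := Finset.sum_nonneg fun i _ => by positivity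
  have h1 : Real.exp (-avQ r y z) * avQ r y z ≤ 1 := by
    rw [Real.exp_neg, inv_mul_le_iff₀ (Real.exp_pos _)]
    linarith [Real.add_one_le_exp (avQ r y z)]
  calc _ ≤ avF r y z * ((∑ i, 2 / r i ^ 2) * avQ r y z) :=
        mul_le_mul_of_nonneg_left (avL_sq r y z hr) (avF_nonneg r y z hr).le
    _ = (avC r * (∑ i, 2 / r i ^ 2)) * (Real.exp (-avQ r y z) * avQ r y z) := by
        unfold avF; ring
    _ ≤ (avC r * (∑ i, 2 / r i ^ 2)) * 1 := mul_le_mul_of_nonneg_left h1 (by positivity)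
    _ = _ := mul_one _

lemma avF1_bound {m : ℕ} (r y z : Fin m → ℝ) (hr : ∀ i, 0 < r i) :
    ‖avF1 r y z‖ ≤ avC r + avC r * (∑ i, 2 / r i ^ 2) := by
  have h0 := avF_nonneg r y z hr
  rw [avF1, norm_smul, Real.norm_of_nonneg h0.le]
  have h1 : ‖avL r y z‖ ≤ 1 + ‖avL r y z‖ ^ 2 := by nlinarith [sq_nonneg (‖avL r y z‖ - 1)]
  have := mul_le_mul_of_nonneg_left h1 h0.le
  linarith [avFL r y z hr, avF_le r y z hr]

lemma avF2_bound {m : ℕ} (r y z : Fin m → ℝ) (hr : ∀ i, 0 < r i) :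
    ‖avF2 r y z‖ ≤ avC r * ‖avM r‖ + avC r * (∑ i, 2 / r i ^ 2) := by
  have h0 := avF_nonneg r y z hr
  unfold avF2
  refine (norm_add_le (avF r y z • avM r) ((avF1 r y z).smulRight (avL r y z))).trans
    (add_le_add ?_ ?_)
  · refine (ContinuousLinearMap.opNorm_smul_le (avF r y z) (avM r)).trans ?_
    rw [Real.norm_of_nonneg h0.le]
    exact mul_le_mul_of_nonneg_right (avF_le r y z hr) (norm_nonneg _)
  · rw [ContinuousLinearMap.norm_smulRight_apply, avF1, norm_smul, Real.norm_of_nonneg h0.le]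
    have := avFL r y z hr
    nlinarith

lemma avF2_cont {m : ℕ} (r y : Fin m → ℝ) (hr : ∀ i, 0 < r i) : Continuous (avF2 r y) := by
  have h1 : Continuous (avF r y) :=
    continuous_iff_continuousAt.2 fun z => (avF_hasFDerivAt r y hr z).continuousAt
  have h2 : Continuous (avF1 r y) :=
    continuous_iff_continuousAt.2 fun z => (avF1_hasFDerivAt r y hr z).continuousAt
  have h3 : Continuous (avL r y) :=
    continuous_iff_continuousAt.2 fun z => (avL_hasFDerivAt r y z).continuousAt
  have h4 : Continuous fun z =>
      ContinuousLinearMap.smulRightL ℝ (Fin m → ℝ) ((Fin m → ℝ) →L[ℝ] ℝ) (avF1 r y z) (avL r y z) := by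
    fun_prop
  exact (h1.smul continuous_const).add h4

lemma avF_eq {m : ℕ} (r y a : Fin m → ℝ) (s : ℝ) :
    (∏ i, gaussPDF (y i - a i * s) 0 (r i ^ 2)) = avF r y (s • a) := by
  unfold gaussPDF avF avC avQ
  rw [Finset.prod_mul_distrib, ← Real.exp_sum, ← Finset.sum_neg_distrib]
  congr 2
  refine Finset.sum_congr rfl fun i _ => ?_
  simp [neg_div, mul_comm]

/-- Hessian at `a = 0` of the log-likelihood `h(a) = log ∫ ∏ᵢ N(yᵢ − aᵢ s; 0, rᵢ²) p(s) ds`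
of the model `yᵢ = aᵢ s + nᵢ`, for a source density `p` with zero mean and unit variance:
`h` is twice differentiable at `0` and
`∂²h/∂aᵢ∂aⱼ(0) = yᵢ yⱼ/(rᵢ² rⱼ²)` for `i ≠ j`, `∂²h/∂aᵢ²(0) = yᵢ²/rᵢ⁴ − 1/rᵢ²`. -/
theorem avica_zero_mixing_hessian
    (p : ℝ → ℝ) (hpmeas : Measurable p) (hpnonneg : 0 ≤ p)
    (hpprob : ∫ s : ℝ, p s = 1)
    (hpmoment1 : Integrable fun s : ℝ => s * p s)
    (hpmean : ∫ s : ℝ, s * p s = 0)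
    (hpmoment2 : Integrable fun s : ℝ => s ^ 2 * p s)
    (hpvar : ∫ s : ℝ, s ^ 2 * p s = 1)
    (m : ℕ) (r y : Fin m → ℝ) (hr : ∀ i, 0 < r i)
    (h : (Fin m → ℝ) → ℝ)
    (hh : ∀ a, h a
      = Real.log (∫ s : ℝ, (∏ i, gaussPDF (y i - a i * s) 0 (r i ^ 2)) * p s)) :
    ContDiffAt ℝ 2 h 0 ∧
    ∀ i j, iteratedFDeriv ℝ 2 h 0 ![Pi.single i 1, Pi.single j 1]
      = if i = j then y i ^ 2 / r i ^ 4 - 1 / r i ^ 2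
        else y i * y j / (r i ^ 2 * r j ^ 2) := by
  have hp : Integrable p := by
    by_contra hc
    rw [integral_undef hc] at hpprob
    exact zero_ne_one hpprob
  have hp2 : Integrable fun s : ℝ => s * (s * p s) := by
    refine hpmoment2.congr (Filter.Eventually.of_forall fun s => ?_)
    simp only; ring
  set H : (Fin m → ℝ) → ℝ := fun a => ∫ s, p s • avF r y (s • a) with hH
  set H1 : (Fin m → ℝ) → (Fin m → ℝ) →L[ℝ] ℝ :=
    fun a => ∫ s, (s * p s) • avF1 r y (s • a) with hH1
  set H2 : (Fin m → ℝ) → (Fin m → ℝ) →L[ℝ] (Fin m → ℝ) →L[ℝ] ℝ :=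
    fun a => ∫ s, (s * (s * p s)) • avF2 r y (s • a) with hH2
  have hFc : Continuous (avF r y) :=
    continuous_iff_continuousAt.2 fun z => (avF_hasFDerivAt r y hr z).continuousAt
  have hF1c : Continuous (avF1 r y) :=
    continuous_iff_continuousAt.2 fun z => (avF1_hasFDerivAt r y hr z).continuousAt
  have hFb : ∀ z, ‖avF r y z‖ ≤ avC r := fun z => by
    rw [Real.norm_of_nonneg (avF_nonneg r y z hr).le]; exact avF_le r y z hr
  have hd1 : ∀ a, HasFDerivAt H (H1 a) a := fun a =>
    avica_key _ _ (avF_hasFDerivAt r y hr) hF1c _ _ hFb (fun z => avF1_bound r y z hr)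
      p hp hpmoment1 a
  have hd2 : ∀ a, HasFDerivAt H1 (H2 a) a := fun a =>
    avica_key _ _ (avF1_hasFDerivAt r y hr) (avF2_cont r y hr) _ _
      (fun z => avF1_bound r y z hr) (fun z => avF2_bound r y z hr) _ hpmoment1 hp2 a
  have hc2 : Continuous H2 :=
    avica_key_cont _ (avF2_cont r y hr) _ (fun z => avF2_bound r y z hr) _ hp2
  have hpos : ∀ a, 0 < H a := by
    intro a
    have hnn : ∀ s, 0 ≤ p s • avF r y (s • a) := fun s =>
      mul_nonneg (hpnonneg s) (avF_nonneg r y _ hr).le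
    have hint : Integrable fun s => p s • avF r y (s • a) := by
      refine Integrable.mono' (hp.norm.mul_const (avC r)) (hp.aestronglyMeasurable.smul
        ((hFc.comp (by fun_prop : Continuous fun s : ℝ => s • a)).aestronglyMeasurable))
        (Filter.Eventually.of_forall fun s => ?_)
      rw [norm_smul]
      exact mul_le_mul_of_nonneg_left (hFb _) (norm_nonneg _)
    refine lt_of_le_of_ne (integral_nonneg hnn) fun h0 => ?_
    have h1 := (integral_eq_zero_iff_of_nonneg hnn hint).1 h0.symm
    have h2 : p =ᵐ[volume] 0 := by
      filter_upwards [h1] with s hs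
      exact (mul_eq_zero.1 hs).resolve_right (avF_nonneg r y _ hr).ne'
    rw [integral_congr_ae h2] at hpprob
    simp at hpprob
  have hhH : h = fun a => Real.log (H a) := by
    funext a
    rw [hh a]
    congr 1
    refine integral_congr_ae (Filter.Eventually.of_forall fun s => ?_)
    simp only [avF_eq, smul_eq_mul]
    ring
  have hcH1 : ContDiff ℝ 1 H1 := by
    refine contDiff_one_iff_hasFDerivAt.2 ⟨H2, hc2, hd2⟩
  have hcH : ContDiff ℝ 2 H := by
    rw [show (2 : WithTop ℕ∞) = 1 + 1 by norm_num]
    exact contDiff_succ_iff_hasFDerivAt.2 ⟨H1, hcH1, hd1⟩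
  refine ⟨?_, ?_⟩
  · rw [hhH]
    exact hcH.contDiffAt.log (hpos 0).ne'
  have hf1 : fderiv ℝ h = fun a => (H a)⁻¹ • H1 a := by
    funext a
    rw [hhH]
    exact ((hd1 a).log (hpos a).ne').fderiv
  have e0 : H 0 = avF r y 0 := by
    simp only [hH, smul_zero, smul_eq_mul]
    rw [integral_mul_const, hpprob, one_mul]
  have e1 : H1 0 = 0 := by
    simp only [hH1, smul_zero]
    rw [integral_smul_const, hpmean, zero_smul]
  have e2 : H2 0 = avF2 r y 0 := by
    simp only [hH2, smul_zero]
    refine (integral_smul_const (fun s : ℝ => s * (s * p s)) (avF2 r y 0)).trans ?_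
    have : ∫ s : ℝ, s * (s * p s) = 1 := by
      rw [← hpvar]
      congr 1
      funext s
      ring
    rw [this, one_smul]
  have hf2 : fderiv ℝ (fderiv ℝ h) 0 = (avF r y 0)⁻¹ • avF2 r y 0 := by
    rw [hf1]
    have h1 := (((hasDerivAt_inv (hpos 0).ne').comp_hasFDerivAt 0 (hd1 0)).smul (hd2 0))
    refine (h1.fderiv).trans ?_
    ext v w
    simp [e0, e1, e2]
  intro i j
  have hF0 := (avF_nonneg r y 0 hr).ne'
  have hri := (hr i).ne'
  have hrj := (hr j).ne'
  have hLi : ∀ k, avL r y 0 (Pi.single k 1) = y k / r k ^ 2 := fun k => by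
    simp [avL, Pi.single_apply]
  have hM : avM r (Pi.single i 1) (Pi.single j 1) = if i = j then -1 / r i ^ 2 else 0 := by
    simp [avM, Pi.single_apply]
    try aesop
  rw [iteratedFDeriv_two_apply, hf2]
  simp only [avF2, avF1, Matrix.cons_val_zero, Matrix.cons_val_one, _root_.smul_apply,
    _root_.add_apply, ContinuousLinearMap.smulRight_apply, hLi, hM, smul_eq_mul]
  split_ifs with hij
  · subst hij
    field_simp
    ring
  · field_simp
    try ring
end

section
/- Let k ≥ 1, let x, s ∈ ℝ^k, let Σ = diag(Σ_1,…,Σ_k) with all Σ_a > 0, and define, for invertible W ∈ ℝ^{k×k}, C(W) = −log|det W| + ½ (Wx − s)^⊤ Σ^{−1} (Wx − s). Set y = Wx. Then the second-order Taylor expansion of C in the relative perturbation ε ∈ ℝ^{k×k} is: C((I + ε)W) = C(W) + ⟨ε, G⟩ + ½ ∑_{a,b,c,d} ε_{ab} H_{abcd} ε_{cd} + o(‖ε‖²) as ε → 0, where G = −I + Σ^{−1}(y − s) y^⊤ (i.e., G_{ab} = −δ_{ab} + (Σ_a)^{−1}(y_a − s_a) y_b) and H_{abcd} = δ_{ad}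 δ_{bc} + δ_{ac} y_b y_d / Σ_a, with ⟨ε, G⟩ = ∑_{a,b} ε_{ab} G_{ab}. -/
open Finset Asymptotics Topology

attribute [local instance] Matrix.normedAddCommGroup

lemma aux_log_one (z : ℂ) (K : ℝ) (hz : ‖z‖ ≤ K) (hK : K ≤ 1 / 2) :
    |Real.log ‖1 + z‖ - z.re + (1 / 2) * (z ^ 2).re| ≤ K ^ 3 := by
  have h0 := norm_nonneg z
  have h := Complex.norm_log_sub_logTaylor_le 2 (z := z) (by linarith)
  have e : Real.log ‖1 + z‖ - z.re + (1 / 2) * (z ^ 2).re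
      = (Complex.log (1 + z) - Complex.logTaylor (2 + 1) z).re := by
    have : Complex.logTaylor (2 + 1) z = z - ((1 / 2 : ℝ) : ℂ) * z ^ 2 := by
      simp [Complex.logTaylor_succ, Complex.logTaylor_zero]; ring
    rw [this, Complex.sub_re, Complex.sub_re, Complex.re_ofReal_mul, Complex.log_re]; ring
  rw [e]
  refine (Complex.abs_re_le_norm _).trans (h.trans ?_)
  have h2 : (1 - ‖z‖)⁻¹ ≤ 2 := by
    rw [inv_le_comm₀ (by linarith) (by norm_num)]; linarith
  have h3 : ‖z‖ ^ 3 ≤ K ^ 3 := by gcongr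
  have h4 : 0 ≤ ‖z‖ ^ 3 := by positivity
  push_cast
  have h5 : ‖z‖ ^ 3 * (1 - ‖z‖)⁻¹ ≤ ‖z‖ ^ 3 * 2 := by gcongr
  norm_num
  linarith

lemma aux_log_multiset (K : ℝ) (hK : K ≤ 1 / 2) (m : Multiset ℂ) (hm : ∀ z ∈ m, ‖z‖ ≤ K) :
    (m.map (fun z => 1 + z)).prod ≠ 0 ∧
    |Real.log ‖(m.map (fun z => 1 + z)).prod‖ - m.sum.re
      + (1 / 2) * ((m.map (fun z => z ^ 2)).sum).re| ≤ m.card * K ^ 3 := by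
  induction m using Multiset.induction_on with
  | empty => simp
  | cons a m ih =>
    obtain ⟨h1, h2⟩ := ih (fun z hz => hm z (Multiset.mem_cons_of_mem hz))
    have ha := hm a (Multiset.mem_cons_self a m)
    have h3 := aux_log_one a K ha hK
    have hne : (1 + a) ≠ 0 := by
      intro h
      have : a = -1 := by linear_combination h
      rw [this] at ha; norm_num at ha; linarith
    simp only [Multiset.map_cons, Multiset.prod_cons, Multiset.sum_cons, Multiset.card_cons]
    refine ⟨mul_ne_zero hne h1, ?_⟩
    rw [norm_mul, Real.log_mul (norm_ne_zero_iff.2 hne) (norm_ne_zero_iff.2 h1),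
      Complex.add_re, Complex.add_re]
    push_cast
    rw [abs_le] at *
    constructor <;> linarith [h2.1, h2.2, h3.1, h3.2]

lemma aux_eval {k : ℕ} (A : Matrix (Fin k) (Fin k) ℂ) (t : ℂ) :
    (Matrix.scalar (Fin k) t - A).det = (A.charpoly.roots.map (fun z => t - z)).prod := by
  rw [← Matrix.eval_charpoly]
  exact (IsAlgClosed.splits A.charpoly).eval_eq_prod_roots_of_monic A.charpoly_monic t

lemma aux_card {k : ℕ} (A : Matrix (Fin k) (Fin k) ℂ) : A.charpoly.roots.card = k := by
  rw [← (IsAlgClosed.splits A.charpoly).natDegree_eq_card_roots, Matrix.charpoly_natDegree_eq_dim,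
    Fintype.card_fin]

lemma aux_det {k : ℕ} (A : Matrix (Fin k) (Fin k) ℂ) (t : ℂ) :
    (Matrix.scalar (Fin k) t + A).det = (A.charpoly.roots.map (fun z => t + z)).prod := by
  have h := aux_eval A (-t)
  have e : Matrix.scalar (Fin k) (-t) - A = -(Matrix.scalar (Fin k) t + A) := by
    rw [map_neg]; abel
  rw [e, Matrix.det_neg, Fintype.card_fin] at h
  have e2 : A.charpoly.roots.map (fun z => -t - z)
      = A.charpoly.roots.map (fun z => (-1) * (t + z)) := by
    congr 1; ext z; ring
  rw [e2, Multiset.prod_map_mul, Multiset.map_const', Multiset.prod_replicate, aux_card] at h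
  exact mul_left_cancel₀ (pow_ne_zero k (by norm_num)) h

lemma aux_trace_sq {k : ℕ} (A : Matrix (Fin k) (Fin k) ℂ) :
    (A * A).trace = (A.charpoly.roots.map (fun z => z ^ 2)).sum := by
  rw [Matrix.trace_eq_sum_roots_charpoly]
  congr 1
  have h : (A * A).charpoly
      = ((A.charpoly.roots.map (fun z => z ^ 2)).map (fun a => Polynomial.X - Polynomial.C a)).prod := by
    apply Polynomial.funext
    intro t
    obtain ⟨u, rfl⟩ : ∃ u : ℂ, t = u ^ 2 := by
      obtain ⟨u, hu⟩ := IsAlgClosed.exists_pow_nat_eq t (n := 2) (by norm_num)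
      exact ⟨u, hu.symm⟩
    rw [Matrix.eval_charpoly, Polynomial.eval_multiset_prod]
    simp only [Multiset.map_map, Function.comp_def, Polynomial.eval_sub, Polynomial.eval_X,
      Polynomial.eval_C]
    have e : Matrix.scalar (Fin k) (u ^ 2) - A * A
        = (Matrix.scalar (Fin k) u - A) * (Matrix.scalar (Fin k) u + A) := by
      have hc : Matrix.scalar (Fin k) u * A = A * Matrix.scalar (Fin k) u :=
        (Matrix.scalar_commute u (fun r => mul_comm u r) A).eq
      rw [map_pow, pow_two, sub_mul, mul_add, mul_add, hc]; abel
    rw [e, Matrix.det_mul, aux_eval, aux_det, ← Multiset.prod_map_mul]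
    congr 2; ext z; ring
  rw [h, Polynomial.roots_multiset_prod_X_sub_C]

lemma aux_root_norm {k : ℕ} (A : Matrix (Fin k) (Fin k) ℂ) (K : ℝ) (hA : ∀ i j, ‖A i j‖ ≤ K)
    (z : ℂ) (hz : z ∈ A.charpoly.roots) : ‖z‖ ≤ k * K := by
  have hr : A.charpoly.IsRoot z := Polynomial.isRoot_of_mem_roots hz
  have he : Module.End.HasEigenvalue (Matrix.toLin' A) z := by
    rw [Module.End.hasEigenvalue_iff_isRoot_charpoly]
    simpa using hr
  obtain ⟨i, hi⟩ := eigenvalue_mem_ball he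
  rw [mem_closedBall_iff_norm] at hi
  calc ‖z‖ ≤ ‖z - A i i‖ + ‖A i i‖ := by simpa using norm_add_le (z - A i i) (A i i)
    _ ≤ ∑ j ∈ Finset.univ.erase i, ‖A i j‖ + ‖A i i‖ := by gcongr
    _ = ∑ j, ‖A i j‖ := Finset.sum_erase_add _ _ (Finset.mem_univ i)
    _ ≤ ∑ j : Fin k, K := Finset.sum_le_sum (fun j _ => hA i j)
    _ = k * K := by simp

lemma aux_logdet {k : ℕ} (E : Matrix (Fin k) (Fin k) ℝ) (hE : k * ‖E‖ ≤ 1 / 2) :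
    (1 + E).det ≠ 0 ∧
    |Real.log |(1 + E).det| - E.trace + (1 / 2) * (E * E).trace| ≤ k * (k * ‖E‖) ^ 3 := by
  set A : Matrix (Fin k) (Fin k) ℂ := E.map (algebraMap ℝ ℂ) with hA
  have hb : ∀ z ∈ A.charpoly.roots, ‖z‖ ≤ k * ‖E‖ :=
    aux_root_norm A ‖E‖ (fun i j => by simpa [hA] using Matrix.norm_entry_le_entrywise_sup_norm E)
  obtain ⟨h1, h2⟩ := aux_log_multiset _ hE _ hb
  rw [aux_card, ← aux_trace_sq, ← Matrix.trace_eq_sum_roots_charpoly, ← aux_det] at h2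
  rw [← aux_det] at h1
  have d : (Matrix.scalar (Fin k) (1 : ℂ) + A).det = ((1 + E).det : ℂ) := by
    have : Matrix.scalar (Fin k) (1 : ℂ) + A = (1 + E).map (algebraMap ℝ ℂ) := by
      rw [map_one, hA, Matrix.map_add _ (map_add _), Matrix.map_one _ (map_zero _) (map_one _)]
    rw [this]
    exact (RingHom.map_det (algebraMap ℝ ℂ) (1 + E)).symm
  have t1 : A.trace.re = E.trace := by simp [hA, Matrix.trace]
  have t2 : (A * A).trace.re = (E * E).trace := by
    rw [hA, ← Matrix.map_mul]; simp [Matrix.trace]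
  rw [d] at h1 h2
  rw [t1, t2, Complex.norm_real, Real.norm_eq_abs] at h2
  exact ⟨by exact_mod_cast h1, h2⟩

/-- Second-order Taylor expansion, in the relative perturbation `ε`, of the complete
negative log-likelihood `C(W) = −log|det W| + ½ (Wx − s)ᵀ Σ⁻¹ (Wx − s)` of one view in
the AVICA EM algorithm: with `y = Wx`,
`C((I + ε)W) = C(W) + ⟨ε, G⟩ + ½ ∑ ε_{ab} H_{abcd} ε_{cd} + o(‖ε‖²)` where
`G_{ab} = −δ_{ab} + Σ_a⁻¹ (y_a − s_a) y_b` and `H_{abcd} = δ_{ad}δ_{bc} + δ_{ac} y_b y_d / Σ_a`. -/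
theorem avica_em_relative_taylor_expansion
    (k : ℕ) (hk : 1 ≤ k) (x s : Fin k → ℝ)
    (Sig : Fin k → ℝ) (hSig : ∀ a, 0 < Sig a)
    (W : Matrix (Fin k) (Fin k) ℝ) (hW : IsUnit W.det)
    (C : Matrix (Fin k) (Fin k) ℝ → ℝ)
    (hC : ∀ M : Matrix (Fin k) (Fin k) ℝ,
      C M = -Real.log |M.det| + (1 / 2) * ∑ a, (M.mulVec x - s) a ^ 2 / Sig a)
    (y : Fin k → ℝ) (hy : y = W.mulVec x)
    (G : Fin k → Fin k → ℝ)
    (hG : ∀ a b, G a b = -(if a = b then (1 : ℝ) else 0) + (y a - s a) * y b / Sig a)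
    (H : Fin k → Fin k → Fin k → Fin k → ℝ)
    (hH : ∀ a b c d, H a b c d
      = (if a = d then (1 : ℝ) else 0) * (if b = c then 1 else 0)
        + (if a = c then (1 : ℝ) else 0) * y b * y d / Sig a) :
    (fun ε : Matrix (Fin k) (Fin k) ℝ =>
        C ((1 + ε) * W)
          - (C W + (∑ a, ∑ b, ε a b * G a b)
            + (1 / 2) * ∑ a, ∑ b, ∑ c, ∑ d, ε a b * H a b c d * ε c d))
      =o[𝓝 0] fun ε : Matrix (Fin k) (Fin k) ℝ => ‖ε‖ ^ 2 := by
  have hquad : ∀ ε : Matrix (Fin k) (Fin k) ℝ, k * ‖ε‖ ≤ 1 / 2 →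
      C ((1 + ε) * W) - (C W + (∑ a, ∑ b, ε a b * G a b)
            + (1 / 2) * ∑ a, ∑ b, ∑ c, ∑ d, ε a b * H a b c d * ε c d)
      = -(Real.log |(1 + ε).det| - ε.trace + (1 / 2) * (ε * ε).trace) := by
    intro ε hε
    have hd := (aux_logdet ε hε).1
    have hz : ((1 + ε) * W).mulVec x = y + ε.mulVec y := by
      rw [← Matrix.mulVec_mulVec, ← hy, Matrix.add_mulVec, Matrix.one_mulVec]
    have hg : ∑ a, ∑ b, ε a b * G a b
        = -ε.trace + ∑ a, (y a - s a) * (ε.mulVec y) a / Sig a := by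
      rw [Matrix.trace, ← Finset.sum_neg_distrib, ← Finset.sum_add_distrib]
      refine Finset.sum_congr rfl fun a _ => ?_
      simp only [hG, mul_add, Finset.sum_add_distrib]
      congr 1
      · simp
      · simp only [Matrix.mulVec, dotProduct, Finset.mul_sum, Finset.sum_div]
        exact Finset.sum_congr rfl fun b _ => by ring
    have hh : ∑ a, ∑ b, ∑ c, ∑ d, ε a b * H a b c d * ε c d
        = (ε * ε).trace + ∑ a, (ε.mulVec y) a ^ 2 / Sig a := by
      rw [Matrix.trace, ← Finset.sum_add_distrib]
      refine Finset.sum_congr rfl fun a _ => ?_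
      simp only [hH, mul_add, add_mul, Finset.sum_add_distrib]
      congr 1
      · simp [Matrix.mul_apply]
      · have : ∀ b, ∑ c, ∑ d, ε a b * ((if a = c then (1 : ℝ) else 0) * y b * y d / Sig a) * ε c d
            = ∑ d, ε a b * (y b * y d / Sig a) * ε a d := by
          intro b
          rw [Finset.sum_eq_single a]
          · simp
          · intro c _ hc
            simp [Ne.symm hc]
          · simp
        simp only [this]
        simp only [Matrix.mulVec, dotProduct, pow_two, Finset.sum_mul_sum, Finset.sum_div]
        exact Finset.sum_congr rfl fun b _ => Finset.sum_congr rfl fun d _ => by ring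
    have hs : ∑ a, (y + ε.mulVec y - s) a ^ 2 / Sig a
        = ∑ a, (y - s) a ^ 2 / Sig a + 2 * ∑ a, (y a - s a) * (ε.mulVec y) a / Sig a
          + ∑ a, (ε.mulVec y) a ^ 2 / Sig a := by
      rw [Finset.mul_sum, ← Finset.sum_add_distrib, ← Finset.sum_add_distrib]
      refine Finset.sum_congr rfl fun a _ => ?_
      simp only [Pi.add_apply, Pi.sub_apply]
      ring
    rw [hC, hC, hz, ← hy, hg, hh, hs, Matrix.det_mul, abs_mul,
      Real.log_mul (abs_ne_zero.2 hd) (abs_ne_zero.2 hW.ne_zero)]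
    ring
  have hev : ∀ᶠ ε : Matrix (Fin k) (Fin k) ℝ in 𝓝 0, (k : ℝ) * ‖ε‖ ≤ 1 / 2 := by
    have : Filter.Tendsto (fun ε : Matrix (Fin k) (Fin k) ℝ => (k : ℝ) * ‖ε‖) (𝓝 0) (𝓝 0) := by
      have h := (tendsto_norm_zero (E := Matrix (Fin k) (Fin k) ℝ)).const_mul (k : ℝ)
      rw [mul_zero] at h
      exact h
    exact this.eventually_le_const (by norm_num)
  have hO : (fun ε : Matrix (Fin k) (Fin k) ℝ =>
        C ((1 + ε) * W)
          - (C W + (∑ a, ∑ b, ε a b * G a b)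
            + (1 / 2) * ∑ a, ∑ b, ∑ c, ∑ d, ε a b * H a b c d * ε c d))
      =O[𝓝 0] fun ε : Matrix (Fin k) (Fin k) ℝ => ‖ε‖ ^ 3 := by
    refine IsBigO.of_bound ((k : ℝ) * k ^ 3) ?_
    filter_upwards [hev] with ε hε
    rw [hquad ε hε, norm_neg, Real.norm_eq_abs, Real.norm_eq_abs,
      abs_of_nonneg (by positivity : 0 ≤ ‖ε‖ ^ 3)]
    refine (aux_logdet ε hε).2.trans (le_of_eq (by ring))
  refine hO.trans_isLittleO ?_
  exact (isLittleO_pow_pow (𝕜 := ℝ) (by norm_num : 2 < 3)).comp_tendsto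
    (tendsto_norm_zero (E := Matrix (Fin k) (Fin k) ℝ))
end
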